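/- Assume the GBDT setup on [a,b] with ξ = a: J = J* = J^{−1} ∈ ℂ^{m×m}; H : [a,b] → ℂ^{m×m} continuous, positive semidefinite; B ∈ ℂ^{n×n} with B − x I_n invertible for x ∈ [a,b]; A(x) = (B − x I_n)^{−1}; Π, S differentiable with Π_x = −i A Π J H, S_x = Π J H J* Π* − (A S + S A*), S(a) = S(a)*, A(a)S(a) − S(a)A(a)* = i Π(a) J Π(a)*, and S(x) invertible on [a,b]. Let W(x,z) be the fundamental solution of w_x = i(z−x)^{−1} J H(x) w with W(a,z) = I_m, and let W̃(x,z) be the fundamental solution of the transformed system w̃_x = i(z−x)^{−1} J H̃(x) w̃ with W̃(a,z) = I_m, where H̃ = w_0* H w_0, w_0(x) = I_m − i J Π(x)* S(x)^{−1} A(x)^{−1} Π(x) and v(x,z) = w_0(x)^{−1}(I_m − i J Π(x)* S(x)^{−1} (A(x) − (z−x)^{−1} I_n)^{−1} Π(x)). Fix ℓ, s with a < s ≤ ℓ ≤ b (and B − s I_n invertible). If the limit W_+(ℓ,s) := lim_{η→0+} W(ℓ, s + iη) exists, then the limit W̃_+(ℓ,s) := lim_{η→0+} W̃(ℓ, s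 + iη) exists and W̃_+(ℓ,s) = v(ℓ,s) W_+(ℓ,s) v(a,s)^{−1}. The analogous statement holds for the limits W_−, W̃_− from the lower half-plane. -/

import Mathlib

open Matrix
open scoped ComplexOrder

attribute [local instance] Matrix.normedAddCommGroup Matrix.normedSpace

/-- `A(x) = (B − x Iₙ)⁻¹`. -/
noncomputable def Amat {n : ℕ} (B : Matrix (Fin n) (Fin n) ℂ) (x : ℝ) :
    Matrix (Fin n) (Fin n) ℂ :=
  (B - (x : ℂ) • (1 : Matrix (Fin n) (Fin n) ℂ))⁻¹

/-- `w₀(x) = I_m − i J Π(x)* S(x)⁻¹ A(x)⁻¹ Π(x)`. -/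
noncomputable def w0fun {m n : ℕ} (J : Matrix (Fin m) (Fin m) ℂ)
    (B : Matrix (Fin n) (Fin n) ℂ) (S : ℝ → Matrix (Fin n) (Fin n) ℂ)
    (Φ : ℝ → Matrix (Fin n) (Fin m) ℂ) (x : ℝ) : Matrix (Fin m) (Fin m) ℂ :=
  1 - Complex.I • (J * (Φ x)ᴴ * (S x)⁻¹ * (Amat B x)⁻¹ * Φ x)

/-- `w_A(x,z) = I_m − i J Π(x)* S(x)⁻¹ (A(x) − (z−x)⁻¹ Iₙ)⁻¹ Π(x)`, where the
resolvent `(A(x) − (z−x)⁻¹ Iₙ)⁻¹` is written via formula (1.17+) as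
`(x−z)(B − x Iₙ)(B − z Iₙ)⁻¹`, which makes sense in a neighbourhood of real
points `z = s`. -/
noncomputable def wAfun {m n : ℕ} (J : Matrix (Fin m) (Fin m) ℂ)
    (B : Matrix (Fin n) (Fin n) ℂ) (S : ℝ → Matrix (Fin n) (Fin n) ℂ)
    (Φ : ℝ → Matrix (Fin n) (Fin m) ℂ) (z : ℂ) (x : ℝ) :
    Matrix (Fin m) (Fin m) ℂ :=
  1 - Complex.I • (J * (Φ x)ᴴ * (S x)⁻¹ *
    (((x : ℂ) - z) • ((B - (x : ℂ) • (1 : Matrix (Fin n) (Fin n) ℂ)) *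
      (B - z • (1 : Matrix (Fin n) (Fin n) ℂ))⁻¹)) * Φ x)

/-- `v(x,z) = w₀(x)⁻¹ w_A(x,z)`. -/
noncomputable def vfun {m n : ℕ} (J : Matrix (Fin m) (Fin m) ℂ)
    (B : Matrix (Fin n) (Fin n) ℂ) (S : ℝ → Matrix (Fin n) (Fin n) ℂ)
    (Φ : ℝ → Matrix (Fin n) (Fin m) ℂ) (z : ℂ) (x : ℝ) :
    Matrix (Fin m) (Fin m) ℂ :=
  (w0fun J B S Φ x)⁻¹ * wAfun J B S Φ z x

section NormedRing

variable {𝔸 : Type*} [NormedRing 𝔸] [NormedAlgebra ℝ 𝔸]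

lemma HasDerivAt.ringInverse_of_isUnit [FiniteDimensional ℝ 𝔸] {F : ℝ → 𝔸} {F' : 𝔸} {x : ℝ}
    (hF : HasDerivAt F F' x) (hx : IsUnit (F x)) :
    HasDerivAt (fun t => Ring.inverse (F t))
      (-(Ring.inverse (F x) * F' * Ring.inverse (F x))) x := by
  have : CompleteSpace 𝔸 := FiniteDimensional.complete ℝ 𝔸
  obtain ⟨u, hu⟩ := hx
  have h := hasFDerivAt_ringInverse (𝕜 := ℝ) u
  rw [hu] at h
  convert! h.comp_hasDerivAt x hF using 1
  simp [← hu]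

/-- A solution of a linear homogeneous ODE with zero initial value vanishes. -/
lemma eq_zero_of_hasDerivAt_mul_add_mul {a b : ℝ} {M N D : ℝ → 𝔸}
    (hM : ContinuousOn M (Set.Icc a b)) (hN : ContinuousOn N (Set.Icc a b))
    (hD : ∀ x ∈ Set.Icc a b, HasDerivAt D (M x * D x + D x * N x) x) (ha : D a = 0) :
    ∀ x ∈ Set.Icc a b, D x = 0 := by
  obtain ⟨k₁, hk₁⟩ := isCompact_Icc.exists_bound_of_continuousOn hM
  obtain ⟨k₂, hk₂⟩ := isCompact_Icc.exists_bound_of_continuousOn hN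
  have hc : ContinuousOn D (Set.Icc a b) := fun x hx => (hD x hx).continuousAt.continuousWithinAt
  intro x hx
  have h := norm_le_gronwallBound_of_norm_deriv_right_le (δ := 0) (K := k₁ + k₂) (ε := 0) hc
    (fun x hx => (hD x (Set.Ico_subset_Icc_self hx)).hasDerivWithinAt) (by simp [ha])
    (fun x hx => by
      have hx' := Set.Ico_subset_Icc_self hx
      calc ‖M x * D x + D x * N x‖ ≤ ‖M x‖ * ‖D x‖ + ‖D x‖ * ‖N x‖ :=
            (norm_add_le _ _).trans (add_le_add (norm_mul_le _ _) (norm_mul_le _ _))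
        _ ≤ (k₁ + k₂) * ‖D x‖ + 0 := by
            nlinarith [hk₁ x hx', hk₂ x hx', norm_nonneg (D x)]) x hx
  simpa [gronwallBound_ε0_δ0] using h

end NormedRing

section MatrixCalculus

variable {l m n : ℕ}

lemma HasDerivAt.matrix_mul_fin {F : ℝ → Matrix (Fin l) (Fin m) ℂ}
    {G : ℝ → Matrix (Fin m) (Fin n) ℂ} {F' : Matrix (Fin l) (Fin m) ℂ}
    {G' : Matrix (Fin m) (Fin n) ℂ} {x : ℝ}
    (hF : HasDerivAt F F' x) (hG : HasDerivAt G G' x) :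
    HasDerivAt (fun t => F t * G t) (F' * G x + F x * G') x := by
  refine hasDerivAt_pi.2 fun i => hasDerivAt_pi.2 fun j => ?_
  have h := HasDerivAt.fun_sum (u := Finset.univ) fun k _ =>
    (hasDerivAt_pi.1 (hasDerivAt_pi.1 hF i) k).mul (hasDerivAt_pi.1 (hasDerivAt_pi.1 hG k) j)
  simpa [Matrix.mul_apply, Finset.sum_add_distrib] using h

lemma HasDerivAt.matrix_conjTranspose_fin {F : ℝ → Matrix (Fin m) (Fin n) ℂ}
    {F' : Matrix (Fin m) (Fin n) ℂ} {x : ℝ} (hF : HasDerivAt F F' x) :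
    HasDerivAt (fun t => (F t)ᴴ) F'ᴴ x := by
  refine hasDerivAt_pi.2 fun i => hasDerivAt_pi.2 fun j => ?_
  exact (hasDerivAt_pi.1 (hasDerivAt_pi.1 hF j) i).star

lemma HasDerivAt.matrix_inv_fin {F : ℝ → Matrix (Fin n) (Fin n) ℂ}
    {F' : Matrix (Fin n) (Fin n) ℂ} {x : ℝ} (hF : HasDerivAt F F' x) (hx : IsUnit (F x)) :
    HasDerivAt (fun t => (F t)⁻¹) (-((F x)⁻¹ * F' * (F x)⁻¹)) x := by
  simp only [Matrix.nonsing_inv_eq_ringInverse]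
  exact @HasDerivAt.ringInverse_of_isUnit _ Matrix.linftyOpNormedRing
    Matrix.linftyOpNormedAlgebra (inferInstanceAs (FiniteDimensional ℝ (Matrix _ _ ℂ))) F F' x hF hx

lemma Matrix.eq_zero_of_hasDerivAt_mul_add_mul {a b : ℝ} {M N D : ℝ → Matrix (Fin n) (Fin n) ℂ}
    (hM : ContinuousOn M (Set.Icc a b)) (hN : ContinuousOn N (Set.Icc a b))
    (hD : ∀ x ∈ Set.Icc a b, HasDerivAt D (M x * D x + D x * N x) x) (ha : D a = 0) :
    ∀ x ∈ Set.Icc a b, D x = 0 :=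
  @_root_.eq_zero_of_hasDerivAt_mul_add_mul _ Matrix.linftyOpNormedRing
    Matrix.linftyOpNormedAlgebra a b M N D hM hN hD ha

end MatrixCalculus

section DarbouxAlgebra

variable {m n : ℕ} {J H : Matrix (Fin m) (Fin m) ℂ} {A S R : Matrix (Fin n) (Fin n) ℂ}
  {P : Matrix (Fin n) (Fin m) ℂ}

/-- The Darboux matrix is right invertible at a real spectral value. -/
lemma darboux_mul_inverse {c : ℂ} (hc : star c = c) (hS : IsUnit S)
    (hid : A * S - S * Aᴴ = Complex.I • (P * J * Pᴴ)) (hR : R * (A - c • 1) = 1) :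
    (1 - Complex.I • (J * Pᴴ * S⁻¹ * R * P)) *
      (1 + Complex.I • (J * Pᴴ * Rᴴ * S⁻¹ * P)) = 1 := by
  have hSl : S⁻¹ * S = 1 := Matrix.nonsing_inv_mul S ((Matrix.isUnit_iff_isUnit_det S).1 hS)
  have hSr : S * S⁻¹ = 1 := Matrix.mul_nonsing_inv S ((Matrix.isUnit_iff_isUnit_det S).1 hS)
  have hR2 : (A - c • 1)ᴴ * Rᴴ = 1 := by rw [← Matrix.conjTranspose_mul, hR]; simp
  have hcc : (A - c • 1)ᴴ = Aᴴ - c • 1 := by simp [hc]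
  rw [hcc] at hR2
  have hid2 : (A - c • 1) * S - S * (Aᴴ - c • 1) = Complex.I • (P * J * Pᴴ) := by
    rw [← hid]; simp [sub_mul, mul_sub]
  have key : Complex.I • (S⁻¹ * R * (P * J * Pᴴ) * Rᴴ * S⁻¹) = Rᴴ * S⁻¹ - S⁻¹ * R := by
    have h1 : Complex.I • (S⁻¹ * R * (P * J * Pᴴ) * Rᴴ * S⁻¹)
        = S⁻¹ * R * (Complex.I • (P * J * Pᴴ)) * Rᴴ * S⁻¹ := by simp
    rw [h1, ← hid2]
    calc _ = S⁻¹ * (R * (A - c • 1)) * S * Rᴴ * S⁻¹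
          - S⁻¹ * R * S * ((Aᴴ - c • 1) * Rᴴ) * S⁻¹ := by noncomm_ring
      _ = S⁻¹ * S * Rᴴ * S⁻¹ - S⁻¹ * R * (S * S⁻¹) := by rw [hR, hR2]; noncomm_ring
      _ = _ := by rw [hSl, hSr]; simp
  have key2 : Complex.I • (J * Pᴴ * (Complex.I • (S⁻¹ * R * (P * J * Pᴴ) * Rᴴ * S⁻¹)) * P)
      = Complex.I • (J * Pᴴ * (Rᴴ * S⁻¹ - S⁻¹ * R) * P) := by rw [key]
  simp only [Matrix.mul_sub, Matrix.sub_mul, Matrix.mul_add, Matrix.mul_assoc,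
    Matrix.mul_smul, Matrix.smul_mul, Matrix.mul_one, Matrix.one_mul, smul_sub] at key2 ⊢
  rw [key2]; abel

/-- The algebraic identity behind the differential equation of the Darboux matrix. -/
lemma darboux_derivative_identity {c : ℂ} (hS : IsUnit S)
    (hid : A * S - S * Aᴴ = Complex.I • (P * J * Pᴴ)) (hR : (A - c • 1) * R = 1)
    (hR' : R * (A - c • 1) = 1) {K T : Matrix (Fin m) (Fin m) ℂ}
    (hK : K = J * Pᴴ * S⁻¹ * P) (hT : T = J * Pᴴ * S⁻¹ * R * P) :
    J * (Complex.I • (H * J * Pᴴ * Aᴴ)) * S⁻¹ * R * P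
      + J * Pᴴ * (-(S⁻¹ * (P * J * H * J * Pᴴ - (A * S + S * Aᴴ)) * S⁻¹)) * R * P
      + J * Pᴴ * S⁻¹ * (-((A + c • 1) * R)) * P
      + J * Pᴴ * S⁻¹ * R * (-(Complex.I • (A * P * J * H)))
    = Complex.I • (((-(Complex.I • K) + J * H * K - K * J * H) + (Complex.I * c) • (J * H)) *
        (1 - Complex.I • T) - (1 - Complex.I • T) * ((Complex.I * c) • (J * H))) := by
  have hSl : S⁻¹ * S = 1 := Matrix.nonsing_inv_mul S ((Matrix.isUnit_iff_isUnit_det S).1 hS)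
  have hSr : S * S⁻¹ = 1 := Matrix.mul_nonsing_inv S ((Matrix.isUnit_iff_isUnit_det S).1 hS)
  have hAR : A * R = 1 + c • R := by
    rw [← hR]; simp [sub_mul]
  have hRA : R * A = 1 + c • R := by
    rw [← hR']; simp [mul_sub]
  have hAS : Aᴴ * S⁻¹ = S⁻¹ * A - Complex.I • (S⁻¹ * P * J * Pᴴ * S⁻¹) := by
    have : Complex.I • (S⁻¹ * P * J * Pᴴ * S⁻¹) = S⁻¹ * (Complex.I • (P * J * Pᴴ)) * S⁻¹ := by
      simp [Matrix.mul_assoc]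
    rw [this, ← hid]
    calc _ = (S⁻¹ * S) * (Aᴴ * S⁻¹) := by rw [hSl, one_mul]
      _ = S⁻¹ * A - (S⁻¹ * A * (S * S⁻¹) - (S⁻¹ * S) * (Aᴴ * S⁻¹)) := by rw [hSr]; simp
      _ = _ := by noncomm_ring
  have e1 : J * (Complex.I • (H * J * Pᴴ * Aᴴ)) * S⁻¹ * R * P
      = Complex.I • (J * H * (J * Pᴴ) * (Aᴴ * S⁻¹) * R * P) := by
    simp [Matrix.mul_assoc]
  have e2 : S⁻¹ * (P * J * H * J * Pᴴ - (A * S + S * Aᴴ)) * S⁻¹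
      = S⁻¹ * P * J * H * J * Pᴴ * S⁻¹ - S⁻¹ * A - Aᴴ * S⁻¹ := by
    calc _ = S⁻¹ * (P * J * H * J * Pᴴ) * S⁻¹ - S⁻¹ * A * (S * S⁻¹) - S⁻¹ * S * (Aᴴ * S⁻¹) := by
          noncomm_ring
      _ = _ := by rw [hSl, hSr]; simp [Matrix.mul_assoc]
  have e3 : (S⁻¹ * A - Complex.I • (S⁻¹ * P * J * Pᴴ * S⁻¹)) * R
      = S⁻¹ + c • (S⁻¹ * R) - Complex.I • (S⁻¹ * P * (J * Pᴴ * S⁻¹ * R)) := by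
    rw [sub_mul, mul_assoc, hAR]; simp [Matrix.mul_assoc, mul_add]
  have t1 : J * H * (J * Pᴴ) * (Aᴴ * S⁻¹) * R * P
      = J * H * (K + c • T - Complex.I • (K * T)) := by
    rw [hAS, Matrix.mul_assoc _ _ R, e3, hK, hT]
    simp only [Matrix.mul_sub, Matrix.sub_mul, Matrix.mul_add, Matrix.add_mul, Matrix.mul_assoc,
      Matrix.mul_smul, Matrix.smul_mul]
  have t2 : J * Pᴴ * (-(S⁻¹ * (P * J * H * J * Pᴴ - (A * S + S * Aᴴ)) * S⁻¹)) * R * P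
      + J * Pᴴ * S⁻¹ * (-((A + c • 1) * R)) * P
      = -(K * J * H * T) + K - Complex.I • (K * T) := by
    rw [e2, hAS, hK, hT]
    have : A * R * P = P + c • (R * P) := by rw [hAR]; simp [Matrix.add_mul]
    rw [Matrix.mul_assoc] at this
    simp only [Matrix.mul_sub, Matrix.sub_mul, Matrix.mul_add, Matrix.add_mul, Matrix.mul_assoc,
      Matrix.mul_smul, Matrix.smul_mul, Matrix.mul_neg, Matrix.neg_mul, this, Matrix.one_mul]
    abel
  have t4 : J * Pᴴ * S⁻¹ * R * (-(Complex.I • (A * P * J * H)))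
      = -(Complex.I • (K * J * H + c • (T * J * H))) := by
    have : R * (A * (P * (J * H))) = P * (J * H) + c • (R * (P * (J * H))) := by
      rw [← Matrix.mul_assoc, hRA]; simp [Matrix.add_mul]
    rw [hK, hT]
    simp only [Matrix.mul_add, Matrix.mul_assoc, Matrix.mul_smul, Matrix.mul_neg, this]
  rw [e1, t1, add_assoc _ _ (J * Pᴴ * S⁻¹ * (-((A + c • 1) * R)) * P), t2, t4]
  simp only [Matrix.mul_sub, Matrix.sub_mul, Matrix.mul_add, Matrix.add_mul, Matrix.mul_assoc,
    Matrix.mul_smul, Matrix.smul_mul, Matrix.neg_mul, Matrix.one_mul,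
    Matrix.mul_one]
  have hI : Complex.I * Complex.I = -1 := Complex.I_mul_I
  match_scalars <;> grind

end DarbouxAlgebra

section DarbouxDerivative

variable {m n : ℕ}

/-- The coefficient of the linear differential equation satisfied by `w₀`. -/
noncomputable def darbouxCoeff (J H : Matrix (Fin m) (Fin m) ℂ) (S : Matrix (Fin n) (Fin n) ℂ)
    (P : Matrix (Fin n) (Fin m) ℂ) : Matrix (Fin m) (Fin m) ℂ :=
  -(Complex.I • (J * Pᴴ * S⁻¹ * P)) + J * H * (J * Pᴴ * S⁻¹ * P) - (J * Pᴴ * S⁻¹ * P) * J * H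

lemma hasDerivAt_darboux {J H : Matrix (Fin m) (Fin m) ℂ} {A : Matrix (Fin n) (Fin n) ℂ}
    {S R : ℝ → Matrix (Fin n) (Fin n) ℂ} {P : ℝ → Matrix (Fin n) (Fin m) ℂ} {x : ℝ} {c : ℂ}
    (hJ : Jᴴ = J) (hH : Hᴴ = H)
    (hP : HasDerivAt P (-(Complex.I • (A * P x * J * H))) x)
    (hSd : HasDerivAt S (P x * J * H * J * (P x)ᴴ - (A * S x + S x * Aᴴ)) x)
    (hRd : HasDerivAt R (-((A + c • 1) * R x)) x) (hS : IsUnit (S x))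
    (hid : A * S x - S x * Aᴴ = Complex.I • (P x * J * (P x)ᴴ)) (hR : (A - c • 1) * R x = 1) :
    HasDerivAt (fun t => 1 - Complex.I • (J * (P t)ᴴ * (S t)⁻¹ * R t * P t))
      ((darbouxCoeff J H (S x) (P x) + (Complex.I * c) • (J * H)) *
          (1 - Complex.I • (J * (P x)ᴴ * (S x)⁻¹ * R x * P x)) -
        (1 - Complex.I • (J * (P x)ᴴ * (S x)⁻¹ * R x * P x)) * ((Complex.I * c) • (J * H))) x := by
  have hR' : R x * (A - c • 1) = 1 := mul_eq_one_comm.1 hR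
  have hd := ((((((hasDerivAt_const x J).matrix_mul_fin hP.matrix_conjTranspose_fin).matrix_mul_fin
    (hSd.matrix_inv_fin hS)).matrix_mul_fin hRd).matrix_mul_fin hP).const_smul
      Complex.I).const_sub (1 : Matrix (Fin m) (Fin m) ℂ)
  convert! hd using 1
  have key := darboux_derivative_identity (H := H) hS hid hR hR' rfl rfl
  have hPc : (-(Complex.I • (A * P x * J * H)))ᴴ = Complex.I • (H * J * (P x)ᴴ * Aᴴ) := by
    simp [Matrix.conjTranspose_mul, hJ, hH, Matrix.mul_assoc]
  have key2 : ∀ X Y : Matrix (Fin m) (Fin m) ℂ, X = Complex.I • Y → Y = -(Complex.I • X) := by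
    rintro X Y rfl
    simp [smul_smul]
  rw [hPc, darbouxCoeff, key2 _ _ key]
  simp only [Matrix.zero_mul, zero_add, Matrix.add_mul]

end DarbouxDerivative

section GBDT

variable {m n : ℕ}

lemma hasDerivAt_sub_ofReal_smul_one (B : Matrix (Fin n) (Fin n) ℂ) (x : ℝ) :
    HasDerivAt (fun t : ℝ => B - (t : ℂ) • (1 : Matrix (Fin n) (Fin n) ℂ)) (-1) x := by
  have h := ((Complex.ofRealCLM.hasDerivAt (x := x)).smul_const
    (1 : Matrix (Fin n) (Fin n) ℂ)).const_sub B
  convert! h using 1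
  simp

lemma hasDerivAt_Amat {B : Matrix (Fin n) (Fin n) ℂ} {x : ℝ}
    (hB : IsUnit (B - (x : ℂ) • (1 : Matrix (Fin n) (Fin n) ℂ))) :
    HasDerivAt (Amat B) (Amat B x * Amat B x) x := by
  have h := (hasDerivAt_sub_ofReal_smul_one B x).matrix_inv_fin hB
  convert! h using 1
  simp [Amat]

lemma isUnit_Amat {B : Matrix (Fin n) (Fin n) ℂ} {x : ℝ}
    (hB : IsUnit (B - (x : ℂ) • (1 : Matrix (Fin n) (Fin n) ℂ))) : IsUnit (Amat B x) :=
  Matrix.isUnit_nonsing_inv_iff.2 hB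

/-- `(x - z) (B - x) (B - z)⁻¹`, the value of `(A(x) - (z - x)⁻¹)⁻¹`. -/
noncomputable def resolventMat (B : Matrix (Fin n) (Fin n) ℂ) (z : ℂ) (x : ℝ) :
    Matrix (Fin n) (Fin n) ℂ :=
  ((x : ℂ) - z) • ((B - (x : ℂ) • (1 : Matrix (Fin n) (Fin n) ℂ)) *
      (B - z • (1 : Matrix (Fin n) (Fin n) ℂ))⁻¹)

lemma Amat_mul_resolventMat {B : Matrix (Fin n) (Fin n) ℂ} {x : ℝ} (z : ℂ)
    (hB : IsUnit (B - (x : ℂ) • (1 : Matrix (Fin n) (Fin n) ℂ))) :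
    Amat B x * resolventMat B z x = ((x : ℂ) - z) • (B - z • (1 : Matrix (Fin n) (Fin n) ℂ))⁻¹ := by
  rw [Amat, resolventMat, Matrix.mul_smul, ← mul_assoc,
    Matrix.nonsing_inv_mul _ ((Matrix.isUnit_iff_isUnit_det _).1 hB), one_mul]

lemma Amat_sub_mul_resolventMat {B : Matrix (Fin n) (Fin n) ℂ} {x : ℝ} {z : ℂ}
    (hB : IsUnit (B - (x : ℂ) • (1 : Matrix (Fin n) (Fin n) ℂ)))
    (hBz : IsUnit (B - z • (1 : Matrix (Fin n) (Fin n) ℂ))) (hz : z - x ≠ 0) :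
    (Amat B x - (z - x)⁻¹ • 1) * resolventMat B z x = 1 := by
  have hQ := Matrix.mul_nonsing_inv _ ((Matrix.isUnit_iff_isUnit_det _).1 hBz)
  have hc : (z - x)⁻¹ * ((x : ℂ) - z) = -1 := by
    rw [← neg_sub z (x : ℂ), mul_neg, inv_mul_cancel₀ hz]
  rw [sub_mul, Amat_mul_resolventMat z hB, resolventMat, Matrix.smul_mul, one_mul, smul_smul, hc,
    neg_one_smul, sub_neg_eq_add]
  refine Eq.trans ?_ hQ
  simp only [sub_mul, Matrix.smul_mul, one_mul, sub_smul]
  abel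

lemma hasDerivAt_resolventMat {B : Matrix (Fin n) (Fin n) ℂ} {x : ℝ} {z : ℂ}
    (hB : IsUnit (B - (x : ℂ) • (1 : Matrix (Fin n) (Fin n) ℂ))) (hz : z - x ≠ 0) :
    HasDerivAt (resolventMat B z) (-((Amat B x + (z - x)⁻¹ • 1) * resolventMat B z x)) x := by
  have h := ((Complex.ofRealCLM.hasDerivAt (x := x)).sub_const z).smul
    ((hasDerivAt_sub_ofReal_smul_one B x).matrix_mul_fin
      (hasDerivAt_const x (B - z • (1 : Matrix (Fin n) (Fin n) ℂ))⁻¹))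
  convert! h using 1
  have hc : (z - x)⁻¹ * ((x : ℂ) - z) = -1 := by
    rw [← neg_sub z (x : ℂ), mul_neg, inv_mul_cancel₀ hz]
  rw [add_mul, Amat_mul_resolventMat z hB, resolventMat, Matrix.smul_mul, one_mul, smul_smul, hc]
  simp
  abel

lemma wAfun_eq (J : Matrix (Fin m) (Fin m) ℂ) (B : Matrix (Fin n) (Fin n) ℂ)
    (S : ℝ → Matrix (Fin n) (Fin n) ℂ) (Φ : ℝ → Matrix (Fin n) (Fin m) ℂ) (z : ℂ) (x : ℝ) :
    wAfun J B S Φ z x = 1 - Complex.I • (J * (Φ x)ᴴ * (S x)⁻¹ * resolventMat B z x * Φ x) :=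
  rfl

lemma isUnit_wAfun {J : Matrix (Fin m) (Fin m) ℂ} {B : Matrix (Fin n) (Fin n) ℂ}
    {S : ℝ → Matrix (Fin n) (Fin n) ℂ} {Φ : ℝ → Matrix (Fin n) (Fin m) ℂ} {x s : ℝ}
    (hB : IsUnit (B - (x : ℂ) • (1 : Matrix (Fin n) (Fin n) ℂ)))
    (hBs : IsUnit (B - (s : ℂ) • (1 : Matrix (Fin n) (Fin n) ℂ))) (hxs : x ≠ s)
    (hS : IsUnit (S x))
    (hid : Amat B x * S x - S x * (Amat B x)ᴴ = Complex.I • (Φ x * J * (Φ x)ᴴ)) :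
    IsUnit (wAfun J B S Φ (s : ℂ) x) := by
  have hz : (s : ℂ) - x ≠ 0 := by exact_mod_cast sub_ne_zero.2 hxs.symm
  have h := darboux_mul_inverse (c := ((s : ℂ) - x)⁻¹) (by simp) hS hid
    (mul_eq_one_comm.1 (Amat_sub_mul_resolventMat hB hBs hz))
  exact IsUnit.of_mul_eq_one _ h

lemma w0fun_mul_inverse {J : Matrix (Fin m) (Fin m) ℂ} {B : Matrix (Fin n) (Fin n) ℂ}
    {S : ℝ → Matrix (Fin n) (Fin n) ℂ} {Φ : ℝ → Matrix (Fin n) (Fin m) ℂ} {x : ℝ}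
    (hB : IsUnit (B - (x : ℂ) • (1 : Matrix (Fin n) (Fin n) ℂ))) (hS : IsUnit (S x))
    (hid : Amat B x * S x - S x * (Amat B x)ᴴ = Complex.I • (Φ x * J * (Φ x)ᴴ)) :
    w0fun J B S Φ x *
      (1 + Complex.I • (J * (Φ x)ᴴ * ((Amat B x)⁻¹)ᴴ * (S x)⁻¹ * Φ x)) = 1 :=
  darboux_mul_inverse (c := 0) (by simp) hS hid (by
    simpa using Matrix.nonsing_inv_mul _ ((Matrix.isUnit_iff_isUnit_det _).1 (isUnit_Amat hB)))

/-- `w₀` is `J`-unitary. -/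
lemma w0fun_mul_J_mul_conjTranspose {J : Matrix (Fin m) (Fin m) ℂ} {B : Matrix (Fin n) (Fin n) ℂ}
    {S : ℝ → Matrix (Fin n) (Fin n) ℂ} {Φ : ℝ → Matrix (Fin n) (Fin m) ℂ} {x : ℝ}
    (hJ : Jᴴ = J)
    (hB : IsUnit (B - (x : ℂ) • (1 : Matrix (Fin n) (Fin n) ℂ))) (hS : IsUnit (S x))
    (hSh : (S x)ᴴ = S x)
    (hid : Amat B x * S x - S x * (Amat B x)ᴴ = Complex.I • (Φ x * J * (Φ x)ᴴ)) :
    w0fun J B S Φ x * (J * (w0fun J B S Φ x)ᴴ) = J := by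
  have h : J * (w0fun J B S Φ x)ᴴ =
      (1 + Complex.I • (J * (Φ x)ᴴ * ((Amat B x)⁻¹)ᴴ * (S x)⁻¹ * Φ x)) * J := by
    have hSi : ((S x)⁻¹)ᴴ = (S x)⁻¹ := by rw [Matrix.conjTranspose_nonsing_inv, hSh]
    simp only [w0fun, Matrix.conjTranspose_sub, Matrix.conjTranspose_smul, Matrix.conjTranspose_mul,
      Matrix.conjTranspose_conjTranspose, hSi, hJ, Matrix.conjTranspose_one]
    simp [Matrix.mul_assoc, mul_add, add_mul]
  rw [h, ← mul_assoc, w0fun_mul_inverse hB hS hid, one_mul]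

lemma hasDerivAt_w0fun {J H : Matrix (Fin m) (Fin m) ℂ} {B : Matrix (Fin n) (Fin n) ℂ}
    {S : ℝ → Matrix (Fin n) (Fin n) ℂ} {Φ : ℝ → Matrix (Fin n) (Fin m) ℂ} {x : ℝ}
    (hJ : Jᴴ = J) (hH : Hᴴ = H)
    (hB : IsUnit (B - (x : ℂ) • (1 : Matrix (Fin n) (Fin n) ℂ)))
    (hΦ : HasDerivAt Φ (-(Complex.I • (Amat B x * Φ x * J * H))) x)
    (hSd : HasDerivAt S
      (Φ x * J * H * J * (Φ x)ᴴ - (Amat B x * S x + S x * (Amat B x)ᴴ)) x)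
    (hS : IsUnit (S x))
    (hid : Amat B x * S x - S x * (Amat B x)ᴴ = Complex.I • (Φ x * J * (Φ x)ᴴ)) :
    HasDerivAt (w0fun J B S Φ) (darbouxCoeff J H (S x) (Φ x) * w0fun J B S Φ x) x := by
  have hA := Matrix.mul_nonsing_inv _ ((Matrix.isUnit_iff_isUnit_det _).1 (isUnit_Amat hB))
  have hA' := Matrix.nonsing_inv_mul _ ((Matrix.isUnit_iff_isUnit_det _).1 (isUnit_Amat hB))
  have hR : HasDerivAt (fun t => (Amat B t)⁻¹) (-((Amat B x + (0 : ℂ) • 1) * (Amat B x)⁻¹)) x := by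
    convert (hasDerivAt_Amat hB).matrix_inv_fin (isUnit_Amat hB) using 1
    rw [← mul_assoc (Amat B x)⁻¹, hA', one_mul, zero_smul, add_zero]
  have h := hasDerivAt_darboux (c := 0) hJ hH hΦ hSd hR hS hid (by simpa using hA)
  simp only [mul_zero, zero_smul, add_zero, sub_zero] at h
  exact h

lemma hasDerivAt_wAfun {J H : Matrix (Fin m) (Fin m) ℂ} {B : Matrix (Fin n) (Fin n) ℂ}
    {S : ℝ → Matrix (Fin n) (Fin n) ℂ} {Φ : ℝ → Matrix (Fin n) (Fin m) ℂ} {x : ℝ} {z : ℂ}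
    (hJ : Jᴴ = J) (hH : Hᴴ = H)
    (hB : IsUnit (B - (x : ℂ) • (1 : Matrix (Fin n) (Fin n) ℂ)))
    (hBz : IsUnit (B - z • (1 : Matrix (Fin n) (Fin n) ℂ))) (hz : z - x ≠ 0)
    (hΦ : HasDerivAt Φ (-(Complex.I • (Amat B x * Φ x * J * H))) x)
    (hSd : HasDerivAt S
      (Φ x * J * H * J * (Φ x)ᴴ - (Amat B x * S x + S x * (Amat B x)ᴴ)) x)
    (hS : IsUnit (S x))
    (hid : Amat B x * S x - S x * (Amat B x)ᴴ = Complex.I • (Φ x * J * (Φ x)ᴴ)) :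
    HasDerivAt (wAfun J B S Φ z)
      ((darbouxCoeff J H (S x) (Φ x) + (Complex.I * (z - x)⁻¹) • (J * H)) * wAfun J B S Φ z x
        - wAfun J B S Φ z x * ((Complex.I * (z - x)⁻¹) • (J * H))) x :=
  hasDerivAt_darboux hJ hH hΦ hSd (hasDerivAt_resolventMat hB hz) hS hid
    (Amat_sub_mul_resolventMat hB hBz hz)

end GBDT

section BoundaryValues

variable {m n : ℕ} {a b : ℝ} {J : Matrix (Fin m) (Fin m) ℂ} {H : ℝ → Matrix (Fin m) (Fin m) ℂ}
  {B : Matrix (Fin n) (Fin n) ℂ} {S : ℝ → Matrix (Fin n) (Fin n) ℂ}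
  {Φ : ℝ → Matrix (Fin n) (Fin m) ℂ}

lemma continuousOn_Amat
    (hB : ∀ x ∈ Set.Icc a b, IsUnit (B - (x : ℂ) • (1 : Matrix (Fin n) (Fin n) ℂ))) :
    ContinuousOn (Amat B) (Set.Icc a b) :=
  fun x hx => (hasDerivAt_Amat (hB x hx)).continuousAt.continuousWithinAt

/-- `S` stays self-adjoint. -/
lemma gbdt_conjTranspose_eq (hJ : Jᴴ = J) (hH : ∀ x ∈ Set.Icc a b, (H x)ᴴ = H x)
    (hB : ∀ x ∈ Set.Icc a b, IsUnit (B - (x : ℂ) • (1 : Matrix (Fin n) (Fin n) ℂ)))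
    (hSd : ∀ x ∈ Set.Icc a b, HasDerivAt S
      (Φ x * J * H x * J * (Φ x)ᴴ - (Amat B x * S x + S x * (Amat B x)ᴴ)) x)
    (hSa : (S a)ᴴ = S a) : ∀ x ∈ Set.Icc a b, (S x)ᴴ = S x := by
  have hA := continuousOn_Amat hB
  have h := Matrix.eq_zero_of_hasDerivAt_mul_add_mul (a := a) (b := b)
    (M := fun x => -Amat B x) (N := fun x => -(Amat B x)ᴴ) (D := fun x => (S x)ᴴ - S x)
    hA.neg (continuous_id.matrix_conjTranspose.comp_continuousOn hA).neg
    (fun x hx => by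
      convert! (hSd x hx).matrix_conjTranspose_fin.sub (hSd x hx) using 1
      simp only [Matrix.conjTranspose_sub, Matrix.conjTranspose_add, Matrix.conjTranspose_mul,
        Matrix.conjTranspose_conjTranspose, hJ, hH x hx, Matrix.mul_assoc]
      noncomm_ring)
    (by simp [hSa])
  exact fun x hx => sub_eq_zero.1 (h x hx)

/-- The GBDT operator identity propagates from `a` to the whole interval. -/
lemma gbdt_identity (hJ : Jᴴ = J) (hH : ∀ x ∈ Set.Icc a b, (H x)ᴴ = H x)
    (hB : ∀ x ∈ Set.Icc a b, IsUnit (B - (x : ℂ) • (1 : Matrix (Fin n) (Fin n) ℂ)))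
    (hΦ : ∀ x ∈ Set.Icc a b, HasDerivAt Φ (-(Complex.I • (Amat B x * Φ x * J * H x))) x)
    (hSd : ∀ x ∈ Set.Icc a b, HasDerivAt S
      (Φ x * J * H x * J * (Φ x)ᴴ - (Amat B x * S x + S x * (Amat B x)ᴴ)) x)
    (hid : Amat B a * S a - S a * (Amat B a)ᴴ = Complex.I • (Φ a * J * (Φ a)ᴴ)) :
    ∀ x ∈ Set.Icc a b,
      Amat B x * S x - S x * (Amat B x)ᴴ = Complex.I • (Φ x * J * (Φ x)ᴴ) := by
  have h := Matrix.eq_zero_of_hasDerivAt_mul_add_mul (a := a) (b := b)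
    (M := fun _ => 0) (N := fun _ => 0)
    (D := fun x => Amat B x * S x - S x * (Amat B x)ᴴ - Complex.I • (Φ x * J * (Φ x)ᴴ))
    continuousOn_const continuousOn_const
    (fun x hx => by
      have hA := hasDerivAt_Amat (hB x hx)
      convert! ((hA.matrix_mul_fin (hSd x hx)).sub
        ((hSd x hx).matrix_mul_fin hA.matrix_conjTranspose_fin)).sub
        ((((hΦ x hx).matrix_mul_fin (hasDerivAt_const x J)).matrix_mul_fin
          (hΦ x hx).matrix_conjTranspose_fin).const_smul Complex.I) using 1
      have hI : Complex.I * Complex.I = -1 := Complex.I_mul_I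
      simp only [Matrix.conjTranspose_neg, Matrix.conjTranspose_smul, Matrix.conjTranspose_mul,
        hJ, hH x hx, Matrix.mul_assoc, Matrix.mul_sub, Matrix.sub_mul, Matrix.mul_add,
        Matrix.add_mul, Matrix.mul_smul, Matrix.smul_mul, Matrix.mul_neg, Matrix.neg_mul,
        Matrix.mul_zero, Matrix.zero_mul, smul_neg, smul_add, smul_smul, Complex.star_def,
        Complex.conj_I, mul_neg, hI]
      module)
    (by simp [hid])
  exact fun x hx => sub_eq_zero.1 (h x hx)

/-- The transformed fundamental solution off the real axis. -/
lemma gbdt_fundamental_eq (hJ : Jᴴ = J) (hHcont : ContinuousOn H (Set.Icc a b))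
    (hH : ∀ x ∈ Set.Icc a b, (H x)ᴴ = H x)
    (hB : ∀ x ∈ Set.Icc a b, IsUnit (B - (x : ℂ) • (1 : Matrix (Fin n) (Fin n) ℂ)))
    (hΦ : ∀ x ∈ Set.Icc a b, HasDerivAt Φ (-(Complex.I • (Amat B x * Φ x * J * H x))) x)
    (hSd : ∀ x ∈ Set.Icc a b, HasDerivAt S
      (Φ x * J * H x * J * (Φ x)ᴴ - (Amat B x * S x + S x * (Amat B x)ᴴ)) x)
    (hSh : ∀ x ∈ Set.Icc a b, (S x)ᴴ = S x)
    (hid : ∀ x ∈ Set.Icc a b,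
      Amat B x * S x - S x * (Amat B x)ᴴ = Complex.I • (Φ x * J * (Φ x)ᴴ))
    (hS : ∀ x ∈ Set.Icc a b, IsUnit (S x)) {z : ℂ} (hz : z.im ≠ 0)
    (hBz : IsUnit (B - z • (1 : Matrix (Fin n) (Fin n) ℂ)))
    (hwa : IsUnit (wAfun J B S Φ z a))
    {W Wt : ℝ → Matrix (Fin m) (Fin m) ℂ} (hWa : W a = 1) (hWta : Wt a = 1)
    (hW : ∀ x ∈ Set.Icc a b, HasDerivAt W
      ((Complex.I * (z - (x : ℂ))⁻¹) • (J * H x * W x)) x)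
    (hWt : ∀ x ∈ Set.Icc a b, HasDerivAt Wt ((Complex.I * (z - (x : ℂ))⁻¹) •
          (J * ((w0fun J B S Φ x)ᴴ * H x * w0fun J B S Φ x) * Wt x)) x)
    {x : ℝ} (hx : x ∈ Set.Icc a b) :
    Wt x = vfun J B S Φ z x * W x * (vfun J B S Φ z a)⁻¹ := by
  have ha : a ∈ Set.Icc a b := ⟨le_rfl, hx.1.trans hx.2⟩
  have hzx : ∀ t : ℝ, z - t ≠ 0 := fun t ht => hz (by simpa using congrArg Complex.im ht)
  have hK : ContinuousOn (fun t => J * (Φ t)ᴴ * (S t)⁻¹ * Φ t) (Set.Icc a b) := fun t ht =>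
    ((((hasDerivAt_const t J).matrix_mul_fin (hΦ t ht).matrix_conjTranspose_fin).matrix_mul_fin
      ((hSd t ht).matrix_inv_fin (hS t ht))).matrix_mul_fin
        (hΦ t ht)).continuousAt.continuousWithinAt
  have hJc : ContinuousOn (fun _ : ℝ => J) (Set.Icc a b) := continuousOn_const
  have hlam : ContinuousOn (fun t : ℝ => Complex.I * (z - (t : ℂ))⁻¹) (Set.Icc a b) :=
    (continuous_const.mul ((continuous_const.sub Complex.continuous_ofReal).inv₀
      hzx)).continuousOn
  have hM : ContinuousOn (fun t => darbouxCoeff J (H t) (S t) (Φ t) +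
      (Complex.I * (z - (t : ℂ))⁻¹) • (J * H t)) (Set.Icc a b) :=
    (((hK.const_smul Complex.I).neg.add ((hJc.mul hHcont).mul hK)).sub
      ((hK.mul hJc).mul hHcont)).add (hlam.smul (hJc.mul hHcont))
  have h := Matrix.eq_zero_of_hasDerivAt_mul_add_mul (N := fun _ => 0)
    (D := fun t => w0fun J B S Φ t * Wt t -
      wAfun J B S Φ z t * W t * ((wAfun J B S Φ z a)⁻¹ * w0fun J B S Φ a))
    hM continuousOn_const
    (fun t ht => by
      have h0 := hasDerivAt_w0fun hJ (hH t ht) (hB t ht) (hΦ t ht) (hSd t ht) (hS t ht) (hid t ht)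
      have hA := hasDerivAt_wAfun hJ (hH t ht) (hB t ht) hBz (hzx t) (hΦ t ht) (hSd t ht)
        (hS t ht) (hid t ht)
      convert! (h0.matrix_mul_fin (hWt t ht)).sub ((hA.matrix_mul_fin (hW t ht)).matrix_mul_fin
        (hasDerivAt_const t ((wAfun J B S Φ z a)⁻¹ * w0fun J B S Φ a))) using 1
      have hu := w0fun_mul_J_mul_conjTranspose hJ (hB t ht) (hS t ht) (hSh t ht) (hid t ht)
      have hu' : w0fun J B S Φ t *
          (J * ((w0fun J B S Φ t)ᴴ * H t * w0fun J B S Φ t) * Wt t) =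
          J * H t * w0fun J B S Φ t * Wt t := by
        simpa only [Matrix.mul_assoc] using congrArg (· * (H t * (w0fun J B S Φ t * Wt t))) hu
      rw [Matrix.mul_smul, hu']
      simp only [Matrix.mul_assoc, Matrix.mul_sub, Matrix.sub_mul, Matrix.add_mul,
        Matrix.mul_smul, Matrix.smul_mul, Matrix.mul_zero]
      module)
    (by simp [hWa, hWta, Matrix.mul_nonsing_inv_cancel_left _ _
          ((Matrix.isUnit_iff_isUnit_det _).1 hwa)])
    x hx
  have hw0 : IsUnit (w0fun J B S Φ x) :=
    IsUnit.of_mul_eq_one _ (w0fun_mul_inverse (hB x hx) (hS x hx) (hid x hx))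
  have hw0a : IsUnit (w0fun J B S Φ a) :=
    IsUnit.of_mul_eq_one _ (w0fun_mul_inverse (hB a ha) (hS a ha) (hid a ha))
  have h' := congrArg ((w0fun J B S Φ x)⁻¹ * ·) (sub_eq_zero.1 h)
  rw [Matrix.nonsing_inv_mul_cancel_left _ _ ((Matrix.isUnit_iff_isUnit_det _).1 hw0)] at h'
  rw [h', vfun, vfun, Matrix.mul_inv_rev,
    Matrix.nonsing_inv_nonsing_inv _ ((Matrix.isUnit_iff_isUnit_det _).1 hw0a)]
  simp only [Matrix.mul_assoc]

lemma Matrix.continuousAt_inv_of_isUnit {M : Matrix (Fin n) (Fin n) ℂ} (hM : IsUnit M) :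
    ContinuousAt Inv.inv M := by
  refine continuousAt_matrix_inv M ?_
  have hd : M.det ≠ 0 := ((Matrix.isUnit_iff_isUnit_det M).1 hM).ne_zero
  rw [Ring.inverse_eq_inv']
  exact continuousAt_inv₀ hd

lemma continuous_sub_smul_one (B : Matrix (Fin n) (Fin n) ℂ) :
    Continuous fun z : ℂ => B - z • (1 : Matrix (Fin n) (Fin n) ℂ) :=
  continuous_const.sub (continuous_id.smul continuous_const)

lemma continuousAt_wAfun (S : ℝ → Matrix (Fin n) (Fin n) ℂ) (x : ℝ) {s : ℂ}
    (hBs : IsUnit (B - s • (1 : Matrix (Fin n) (Fin n) ℂ))) :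
    ContinuousAt (fun z => wAfun J B S Φ z x) s := by
  have hQ : ContinuousAt (fun z : ℂ => (B - z • (1 : Matrix (Fin n) (Fin n) ℂ))⁻¹) s :=
    ContinuousAt.comp (f := fun z : ℂ => B - z • (1 : Matrix (Fin n) (Fin n) ℂ))
      (Matrix.continuousAt_inv_of_isUnit hBs) (continuous_sub_smul_one B).continuousAt
  have hF : Continuous fun p : ℂ × Matrix (Fin n) (Fin n) ℂ =>
      (1 : Matrix (Fin m) (Fin m) ℂ) - Complex.I • (J * (Φ x)ᴴ * (S x)⁻¹ *
        (((x : ℂ) - p.1) • ((B - (x : ℂ) • (1 : Matrix (Fin n) (Fin n) ℂ)) * p.2)) * Φ x) := by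
    fun_prop
  exact ContinuousAt.comp (f := fun z : ℂ => (z, (B - z • (1 : Matrix (Fin n) (Fin n) ℂ))⁻¹))
    hF.continuousAt (continuousAt_id.prodMk hQ)

lemma Matrix.eventually_isUnit {M : Matrix (Fin n) (Fin n) ℂ} (hM : IsUnit M) :
    ∀ᶠ X in nhds M, IsUnit X := by
  have hd : M.det ≠ 0 := ((Matrix.isUnit_iff_isUnit_det M).1 hM).ne_zero
  filter_upwards [(Continuous.matrix_det continuous_id).continuousAt.eventually_ne hd] with X hX
  exact (Matrix.isUnit_iff_isUnit_det X).2 (isUnit_iff_ne_zero.2 hX)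

end BoundaryValues

/-- Proposition 3.1: the boundary values of the GBDT-transformed
fundamental solution are obtained from those of the initial one by multiplication
with the Darboux matrices `v(ℓ,s)` and `v(a,s)⁻¹`. -/
theorem stmt_9 {m n : ℕ} (a b : ℝ) (hab : a ≤ b)
    (J : Matrix (Fin m) (Fin m) ℂ) (hJherm : Jᴴ = J) (hJinv : J * J = 1)
    (H : ℝ → Matrix (Fin m) (Fin m) ℂ) (hHcont : ContinuousOn H (Set.Icc a b))
    (hHpos : ∀ x ∈ Set.Icc a b, (H x).PosSemidef)
    (B : Matrix (Fin n) (Fin n) ℂ)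
    (hB : ∀ x ∈ Set.Icc a b,
      IsUnit (B - (x : ℂ) • (1 : Matrix (Fin n) (Fin n) ℂ)))
    (Φ : ℝ → Matrix (Fin n) (Fin m) ℂ) (S : ℝ → Matrix (Fin n) (Fin n) ℂ)
    (hΦ : ∀ x ∈ Set.Icc a b,
      HasDerivAt Φ (-(Complex.I • (Amat B x * Φ x * J * H x))) x)
    (hS : ∀ x ∈ Set.Icc a b, HasDerivAt S
      (Φ x * J * H x * Jᴴ * (Φ x)ᴴ - (Amat B x * S x + S x * (Amat B x)ᴴ)) x)
    (hSa : S a = (S a)ᴴ)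
    (hid : Amat B a * S a - S a * (Amat B a)ᴴ = Complex.I • (Φ a * J * (Φ a)ᴴ))
    (hSinv : ∀ x ∈ Set.Icc a b, IsUnit (S x))
    (W Wt : ℝ → ℂ → Matrix (Fin m) (Fin m) ℂ)
    (hW : ∀ z : ℂ, z.im ≠ 0 → W a z = 1 ∧
      ∀ x ∈ Set.Icc a b, HasDerivAt (fun t : ℝ => W t z)
        ((Complex.I * (z - (x : ℂ))⁻¹) • (J * H x * W x z)) x)
    (hWt : ∀ z : ℂ, z.im ≠ 0 → Wt a z = 1 ∧
      ∀ x ∈ Set.Icc a b, HasDerivAt (fun t : ℝ => Wt t z)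
        ((Complex.I * (z - (x : ℂ))⁻¹) •
          (J * ((w0fun J B S Φ x)ᴴ * H x * w0fun J B S Φ x) * Wt x z)) x)
    (ℓ s : ℝ) (has : a < s) (hsl : s ≤ ℓ) (hlb : ℓ ≤ b)
    (hBs : IsUnit (B - (s : ℂ) • (1 : Matrix (Fin n) (Fin n) ℂ))) :
    (∀ Wp : Matrix (Fin m) (Fin m) ℂ,
      Filter.Tendsto (fun η : ℝ => W ℓ ((s : ℂ) + (η : ℂ) * Complex.I))
        (nhdsWithin 0 (Set.Ioi 0)) (nhds Wp) →
      Filter.Tendsto (fun η : ℝ => Wt ℓ ((s : ℂ) + (η : ℂ) * Complex.I))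
        (nhdsWithin 0 (Set.Ioi 0))
        (nhds (vfun J B S Φ (s : ℂ) ℓ * Wp * (vfun J B S Φ (s : ℂ) a)⁻¹)))
    ∧
    (∀ Wm : Matrix (Fin m) (Fin m) ℂ,
      Filter.Tendsto (fun η : ℝ => W ℓ ((s : ℂ) - (η : ℂ) * Complex.I))
        (nhdsWithin 0 (Set.Ioi 0)) (nhds Wm) →
      Filter.Tendsto (fun η : ℝ => Wt ℓ ((s : ℂ) - (η : ℂ) * Complex.I))
        (nhdsWithin 0 (Set.Ioi 0))
        (nhds (vfun J B S Φ (s : ℂ) ℓ * Wm * (vfun J B S Φ (s : ℂ) a)⁻¹))) := by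
  have hH : ∀ x ∈ Set.Icc a b, (H x)ᴴ = H x := fun x hx => (hHpos x hx).isHermitian
  rw [hJherm] at hS
  have hSh := gbdt_conjTranspose_eq hJherm hH hB hS hSa.symm
  have hid' := gbdt_identity hJherm hH hB hΦ hS hid
  have ha : a ∈ Set.Icc a b := ⟨le_rfl, hab⟩
  have hℓ : ℓ ∈ Set.Icc a b := ⟨has.le.trans hsl, hlb⟩
  have hwa : IsUnit (wAfun J B S Φ (s : ℂ) a) :=
    isUnit_wAfun (hB a ha) hBs has.ne (hSinv a ha) hid
  have hw0a : IsUnit (w0fun J B S Φ a) :=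
    IsUnit.of_mul_eq_one _ (w0fun_mul_inverse (hB a ha) (hSinv a ha) hid)
  have hva : IsUnit (vfun J B S Φ (s : ℂ) a) := (Matrix.isUnit_nonsing_inv_iff.2 hw0a).mul hwa
  have hv : ∀ x, ContinuousAt (fun z => vfun J B S Φ z x) (s : ℂ) := fun x =>
    continuousAt_const.mul (continuousAt_wAfun S x hBs)
  have main : ∀ g : ℝ → ℂ, Continuous g → g 0 = s → (∀ η > 0, (g η).im ≠ 0) →
      ∀ L : Matrix (Fin m) (Fin m) ℂ,
      Filter.Tendsto (fun η => W ℓ (g η)) (nhdsWithin 0 (Set.Ioi 0)) (nhds L) →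
      Filter.Tendsto (fun η => Wt ℓ (g η)) (nhdsWithin 0 (Set.Ioi 0))
        (nhds (vfun J B S Φ (s : ℂ) ℓ * L * (vfun J B S Φ (s : ℂ) a)⁻¹)) := by
    intro g hg hg0 him L hL
    have hgs : Filter.Tendsto g (nhdsWithin 0 (Set.Ioi 0)) (nhds (s : ℂ)) := by
      rw [← hg0]
      exact hg.continuousAt.tendsto.mono_left nhdsWithin_le_nhds
    have hinv : Filter.Tendsto (fun η => (vfun J B S Φ (g η) a)⁻¹) (nhdsWithin 0 (Set.Ioi 0))
        (nhds (vfun J B S Φ (s : ℂ) a)⁻¹) :=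
      (Matrix.continuousAt_inv_of_isUnit hva).tendsto.comp ((hv a).tendsto.comp hgs)
    refine ((((hv ℓ).tendsto.comp hgs).mul hL).mul hinv).congr' ?_
    filter_upwards [self_mem_nhdsWithin,
      hgs.eventually ((continuous_sub_smul_one B).continuousAt.tendsto.eventually
        (Matrix.eventually_isUnit hBs)),
      hgs.eventually ((continuousAt_wAfun S a hBs).tendsto.eventually
        (Matrix.eventually_isUnit hwa))] with η hη hBη hwη
    have hz := him η hη
    exact (gbdt_fundamental_eq hJherm hHcont hH hB hΦ hS hSh hid' hSinv hz hBη hwη (hW _ hz).1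
      (hWt _ hz).1 (hW _ hz).2 (hWt _ hz).2 hℓ).symm
  refine ⟨main _ (by fun_prop) (by simp) fun η hη => ?_,
    main _ (by fun_prop) (by simp) fun η hη => ?_⟩ <;> simpa using hη.ne'
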